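/- arXiv:2205.12703 — 5 statements merged into one kernel-verified Lean document; each statement's English description precedes it below -/
import Mathlib

section
/- Let G be a prevariety of group languages over a finite alphabet A and let η : A* → N be a G⁺-morphism, where G⁺ is the well-suited extension of G. Then the image G = η(A⁺) of the nonempty words is a group (a subsemigroup of N which is a group), and the map β : A* → G defined by β(ε) = 1_G and β(w) = η(w) for nonempty w is a monoid morphism which is a G-morphism. -/
/- Common definitions: languages over a finite alphabet, classes of languages,
prevarieties, polynomial closure and its variants, separation, C-pairs, etc. -/

namespace RegLang

variable {A : Type}

/-- A language over the alphabet `A`: a set of finite words. -/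
abbrev Lang (A : Type) := Set (FreeMonoid A)

/-- A class of languages over the alphabet `A`. -/
abbrev LangClass (A : Type) := Set (Lang A)

/-- A lattice of languages: contains `∅` and `A*` and is closed under binary
union and intersection. -/
def IsLatticeClass (C : LangClass A) : Prop :=
  ∅ ∈ C ∧ (Set.univ : Lang A) ∈ C ∧
    (∀ K L : Lang A, K ∈ C → L ∈ C → K ∪ L ∈ C) ∧
    (∀ K L : Lang A, K ∈ C → L ∈ C → K ∩ L ∈ C)

/-- A Boolean algebra of languages: a lattice of languages closed under complement. -/
def IsBooleanAlgebraClass (C : LangClass A) : Prop :=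
  IsLatticeClass C ∧ ∀ L ∈ C, Lᶜ ∈ C

/-- A class is quotient-closed if it is closed under left and right quotients by words. -/
def QuotientClosed (C : LangClass A) : Prop :=
  ∀ L ∈ C, ∀ u : FreeMonoid A,
    {w : FreeMonoid A | u * w ∈ L} ∈ C ∧ {w : FreeMonoid A | w * u ∈ L} ∈ C

/-- A language is regular if it is a preimage of a subset under a monoid morphism
into a finite monoid. -/
def IsRegularLang (L : Lang A) : Prop :=
  ∃ (M : Type) (_ : Monoid M) (_ : Finite M) (φ : FreeMonoid A →* M) (F : Set M),
    L = φ ⁻¹' F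

/-- A positive prevariety: a quotient-closed lattice of regular languages. -/
def IsPositivePrevariety (C : LangClass A) : Prop :=
  IsLatticeClass C ∧ QuotientClosed C ∧ ∀ L ∈ C, IsRegularLang L

/-- A prevariety: a quotient-closed Boolean algebra of regular languages. -/
def IsPrevariety (C : LangClass A) : Prop :=
  IsBooleanAlgebraClass C ∧ QuotientClosed C ∧ ∀ L ∈ C, IsRegularLang L

/-- The marked concatenation `KaL = {uav : u ∈ K, v ∈ L}`. -/
def MarkedCat (K : Lang A) (a : A) (L : Lang A) : Lang A :=
  {w | ∃ u ∈ K, ∃ v ∈ L, w = u * FreeMonoid.of a * v}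

/-- A marked concatenation `KaL` is unambiguous if every word of `KaL` has a
unique factorization `uav` with `u ∈ K` and `v ∈ L`. -/
def Unambiguous (K : Lang A) (a : A) (L : Lang A) : Prop :=
  ∀ u u' v v' : FreeMonoid A, u ∈ K → u' ∈ K → v ∈ L → v' ∈ L →
    u * FreeMonoid.of a * v = u' * FreeMonoid.of a * v' → u = u' ∧ v = v'

/-- The marked concatenation `KaL` is left deterministic: `K ∩ KaA* = ∅`. -/
def LeftDeterministic (K : Lang A) (a : A) (_L : Lang A) : Prop :=
  K ∩ MarkedCat K a Set.univ = ∅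

/-- The marked concatenation `KaL` is right deterministic: `L ∩ A*aL = ∅`. -/
def RightDeterministic (_K : Lang A) (a : A) (L : Lang A) : Prop :=
  L ∩ MarkedCat Set.univ a L = ∅

/-- Polynomial closure: the least class containing `C` and closed under binary
union and marked concatenation. -/
inductive Pol (C : LangClass A) : Lang A → Prop
  | base {L : Lang A} : L ∈ C → Pol C L
  | union {K L : Lang A} : Pol C K → Pol C L → Pol C (K ∪ L)
  | mcat {K L : Lang A} (a : A) : Pol C K → Pol C L → Pol C (MarkedCat K a L)

/-- `coPol C`: the class of complements of languages in `Pol C`. -/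
def coPol (C : LangClass A) : LangClass A := {L | ∃ K : Lang A, Pol C K ∧ L = Kᶜ}

/-- `BPol C`: the least Boolean algebra of languages containing `Pol C`. -/
inductive BPol (C : LangClass A) : Lang A → Prop
  | base {L : Lang A} : Pol C L → BPol C L
  | empty : BPol C ∅
  | univ : BPol C Set.univ
  | union {K L : Lang A} : BPol C K → BPol C L → BPol C (K ∪ L)
  | inter {K L : Lang A} : BPol C K → BPol C L → BPol C (K ∩ L)
  | compl {L : Lang A} : BPol C L → BPol C Lᶜ

/-- Unambiguous polynomial closure: the least class containing `C` and closed
under disjoint union and unambiguous marked concatenation. -/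
inductive UPol (C : LangClass A) : Lang A → Prop
  | base {L : Lang A} : L ∈ C → UPol C L
  | disjUnion {K L : Lang A} : UPol C K → UPol C L → K ∩ L = ∅ → UPol C (K ∪ L)
  | mcat {K L : Lang A} (a : A) : UPol C K → UPol C L → Unambiguous K a L →
      UPol C (MarkedCat K a L)

/-- Alternated polynomial closure: the least class containing `C` and closed under
disjoint union and left- and right-deterministic marked concatenation. -/
inductive APol (C : LangClass A) : Lang A → Prop
  | base {L : Lang A} : L ∈ C → APol C L
  | disjUnion {K L : Lang A} : APol C K → APol C L → K ∩ L = ∅ → APol C (K ∪ L)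
  | leftCat {K L : Lang A} (a : A) : APol C K → APol C L → LeftDeterministic K a L →
      APol C (MarkedCat K a L)
  | rightCat {K L : Lang A} (a : A) : APol C K → APol C L → RightDeterministic K a L →
      APol C (MarkedCat K a L)

/-- `KaL` is left `C`-deterministic: there are `K', L' ∈ C` with `K ⊆ K'`, `L ⊆ L'`
and `K'aL'` left deterministic. -/
def LeftCDeterministic (C : LangClass A) (K : Lang A) (a : A) (L : Lang A) : Prop :=
  ∃ K' ∈ C, ∃ L' ∈ C, K ⊆ K' ∧ L ⊆ L' ∧ LeftDeterministic K' a L'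

/-- `KaL` is right `C`-deterministic: there are `K', L' ∈ C` with `K ⊆ K'`, `L ⊆ L'`
and `K'aL'` right deterministic. -/
def RightCDeterministic (C : LangClass A) (K : Lang A) (a : A) (L : Lang A) : Prop :=
  ∃ K' ∈ C, ∃ L' ∈ C, K ⊆ K' ∧ L ⊆ L' ∧ RightDeterministic K' a L'

/-- Weak alternated polynomial closure: the least class containing `C` and closed under
disjoint union and left- and right-`C`-deterministic marked concatenation. -/
inductive WAPol (C : LangClass A) : Lang A → Prop
  | base {L : Lang A} : L ∈ C → WAPol C L
  | disjUnion {K L : Lang A} : WAPol C K → WAPol C L → K ∩ L = ∅ → WAPol C (K ∪ L)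
  | leftCat {K L : Lang A} (a : A) : WAPol C K → WAPol C L →
      LeftCDeterministic C K a L → WAPol C (MarkedCat K a L)
  | rightCat {K L : Lang A} (a : A) : WAPol C K → WAPol C L →
      RightCDeterministic C K a L → WAPol C (MarkedCat K a L)

/-- `K` separates `L₁` from `L₂`. -/
def Separates (K L₁ L₂ : Lang A) : Prop := L₁ ⊆ K ∧ K ∩ L₂ = ∅

/-- `L₁` is `C`-separable from `L₂`. -/
def Separable (C : LangClass A) (L₁ L₂ : Lang A) : Prop := ∃ K ∈ C, Separates K L₁ L₂

/-- `(s, t)` is a `C`-pair for `φ`: `φ⁻¹(s)` is not `C`-separable from `φ⁻¹(t)`. -/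
def CPair (C : LangClass A) {M : Type} [Monoid M] (φ : FreeMonoid A →* M)
    (s t : M) : Prop :=
  ¬ Separable C (φ ⁻¹' {s}) (φ ⁻¹' {t})

/-- The canonical `C`-preorder on `M` associated with `φ`. -/
def CPreorder (C : LangClass A) {M : Type} [Monoid M] (φ : FreeMonoid A →* M)
    (s t : M) : Prop :=
  ∀ F : Set M, φ ⁻¹' F ∈ C → s ∈ F → t ∈ F

/-- The canonical `C`-equivalence on `M` associated with `φ`. -/
def CEquiv (C : LangClass A) {M : Type} [Monoid M] (φ : FreeMonoid A →* M)
    (s t : M) : Prop :=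
  ∀ F : Set M, φ ⁻¹' F ∈ C → (s ∈ F ↔ t ∈ F)

/-- A `C`-morphism: a surjective morphism all of whose recognized languages are in `C`. -/
def IsCMorphism (C : LangClass A) {N : Type} [Monoid N] (η : FreeMonoid A →* N) : Prop :=
  Function.Surjective η ∧ ∀ F : Set N, η ⁻¹' F ∈ C

/-- `e` is the idempotent power `s^ω` of `s`: an idempotent of the form `s^n`, `n ≥ 1`
(in a finite monoid such an element exists and is unique). -/
def IsIdempotentPower {M : Type} [Monoid M] (s e : M) : Prop :=
  IsIdempotentElem e ∧ ∃ n : ℕ, 1 ≤ n ∧ e = s ^ n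

/-- The `C`-kernel of `φ`: the elements `s` such that `{ε}` is not `C`-separable
from `φ⁻¹(s)`. -/
def gKernel (C : LangClass A) {M : Type} [Monoid M] (φ : FreeMonoid A →* M) : Set M :=
  {s | ¬ Separable C ({1} : Lang A) (φ ⁻¹' {s})}

/-- The strict `C`-kernel of `φ`: the intersection of the `C`-kernel with `φ(A⁺)`. -/
def strictGKernel (C : LangClass A) {M : Type} [Monoid M]
    (φ : FreeMonoid A →* M) : Set M :=
  gKernel C φ ∩ φ '' {w : FreeMonoid A | w ≠ 1}

/-- A group language: one recognized by a morphism into a finite group. -/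
def IsGroupLanguage (L : Lang A) : Prop :=
  ∃ (G : Type) (_ : Group G) (_ : Finite G) (φ : FreeMonoid A →* G) (F : Set G),
    L = φ ⁻¹' F

/-- A prevariety of group languages. -/
def IsGroupPrevariety (G : LangClass A) : Prop :=
  IsPrevariety G ∧ ∀ L ∈ G, IsGroupLanguage L

/-- The well-suited extension `G⁺`: all languages `L ∩ A⁺` and `L ∪ {ε}` for `L ∈ G`. -/
def wellSuited (G : LangClass A) : LangClass A :=
  {L | ∃ K ∈ G, L = K ∩ {w : FreeMonoid A | w ≠ 1} ∨ L = K ∪ ({1} : Lang A)}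

/-- `le` is a partial order on the monoid `N` compatible with multiplication. -/
def IsCompatiblePartialOrder {N : Type} [Monoid N] (le : N → N → Prop) : Prop :=
  (∀ x, le x x) ∧ (∀ x y z, le x y → le y z → le x z) ∧
    (∀ x y, le x y → le y x → x = y) ∧
    (∀ x x' y y', le x y → le x' y' → le (x * x') (y * y'))

/-- `F` is upward closed for the relation `le`. -/
def UpClosed {N : Type} (le : N → N → Prop) (F : Set N) : Prop :=
  ∀ s ∈ F, ∀ t, le s t → t ∈ F

/-- An ordered `C`-morphism: a surjective morphism onto a finite ordered monoid such
that preimages of upward closed sets are in `C`. -/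
def IsOrderedCMorphism (C : LangClass A) {N : Type} [Monoid N]
    (η : FreeMonoid A →* N) (le : N → N → Prop) : Prop :=
  Function.Surjective η ∧ IsCompatiblePartialOrder le ∧
    ∀ F : Set N, UpClosed le F → η ⁻¹' F ∈ C

/-- The syntactic preorder of `L`: `u ≼_L v` iff `xuy ∈ L → xvy ∈ L` for all `x, y`. -/
def SynPre (L : Lang A) (u v : FreeMonoid A) : Prop :=
  ∀ x y : FreeMonoid A, x * u * y ∈ L → x * v * y ∈ L

/-- `φ` is (a copy of) the syntactic morphism of `L`: it is surjective and identifies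
exactly the words that are syntactically congruent for `L`. -/
def IsSyntacticMorphism (L : Lang A) {M : Type} [Monoid M]
    (φ : FreeMonoid A →* M) : Prop :=
  Function.Surjective φ ∧
    ∀ u v : FreeMonoid A, φ u = φ v ↔ ∀ x y : FreeMonoid A, (x * u * y ∈ L ↔ x * v * y ∈ L)

/-- `le` is (a copy of) the syntactic order of `L` on the target of `φ`. -/
def IsSyntacticOrder (L : Lang A) {M : Type} [Monoid M] (φ : FreeMonoid A →* M)
    (le : M → M → Prop) : Prop :=
  ∀ u v : FreeMonoid A, le (φ u) (φ v) ↔ SynPre L u v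

/-- In a group language, factors `u ^ n` can be inserted and deleted freely, for all
multiples `n` of some positive period. -/
theorem IsGroupLanguage.exists_period {L : Lang A} (hL : IsGroupLanguage L) :
    ∃ p : ℕ, 0 < p ∧ ∀ n : ℕ, p ∣ n → ∀ x u y : FreeMonoid A,
      x * u ^ n * y ∈ L ↔ x * y ∈ L := by
  obtain ⟨H, _, _, φ, F, rfl⟩ := hL
  refine ⟨Nat.card H, Nat.card_pos, ?_⟩
  rintro n ⟨k, rfl⟩ x u y
  simp [pow_mul]

/-- On nonempty words, a language of the well-suited extension agrees with one of the
original class. -/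
theorem exists_mem_iff_of_mem_wellSuited {G : LangClass A} {L : Lang A}
    (hL : L ∈ wellSuited G) :
    ∃ K ∈ G, ∀ w : FreeMonoid A, w ≠ 1 → (w ∈ L ↔ w ∈ K) := by
  obtain ⟨K, hK, rfl | rfl⟩ := hL
  · exact ⟨K, hK, fun w hw => by simp [hw]⟩
  · exact ⟨K, hK, fun w hw => by simp [hw]⟩

theorem mul_ne_one_of_left {u : FreeMonoid A} (hu : u ≠ 1) (v : FreeMonoid A) :
    u * v ≠ 1 := by
  intro h
  have h' := congrArg FreeMonoid.length h
  simp only [FreeMonoid.length_mul, FreeMonoid.length_one] at h'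
  exact hu (FreeMonoid.length_eq_zero.mp (by omega))

theorem mul_ne_one_of_right (u : FreeMonoid A) {v : FreeMonoid A} (hv : v ≠ 1) :
    u * v ≠ 1 := by
  intro h
  have h' := congrArg FreeMonoid.length h
  simp only [FreeMonoid.length_mul, FreeMonoid.length_one] at h'
  exact hv (FreeMonoid.length_eq_zero.mp (by omega))

theorem pow_ne_one_of_ne_one {u : FreeMonoid A} (hu : u ≠ 1) {n : ℕ} (hn : 0 < n) :
    u ^ n ≠ 1 := by
  obtain ⟨m, rfl⟩ := Nat.exists_eq_succ_of_ne_zero hn.ne'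
  rw [pow_succ]
  exact mul_ne_one_of_right _ hu

/-- For a morphism recognizing only languages of `G⁺`, some power `u ^ n` of any word can be
inserted into any nonempty word without changing its image. -/
theorem exists_pow_insertion {G : LangClass A} (hG : ∀ L ∈ G, IsGroupLanguage L)
    {N : Type} [Monoid N] [Finite N] (η : FreeMonoid A →* N)
    (hη : ∀ F : Set N, η ⁻¹' F ∈ wellSuited G) :
    ∃ n : ℕ, 0 < n ∧ ∀ x u y : FreeMonoid A, x * y ≠ 1 →
      η (x * u ^ n * y) = η (x * y) := by
  have : Fintype N := Fintype.ofFinite N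
  choose K hK hKη using fun s : N => exists_mem_iff_of_mem_wellSuited (hη {s})
  choose p hp hpK using fun s : N => (hG _ (hK s)).exists_period
  refine ⟨∏ s, p s, Finset.prod_pos fun s _ => hp s, fun x u y hxy => ?_⟩
  have hne : x * u ^ (∏ s, p s) * y ≠ 1 := by
    by_cases hx : x = 1
    · subst hx
      exact mul_ne_one_of_right _ (by simpa using hxy)
    · exact mul_ne_one_of_left (mul_ne_one_of_left hx _) _
  have hmem : x * y ∈ K (η (x * y)) := (hKη _ _ hxy).mp rfl
  exact (hKη _ _ hne).mpr
    ((hpK _ _ (Finset.dvd_prod_of_mem p (Finset.mem_univ _)) x u y).mpr hmem)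

/-- for a `G⁺`-morphism `η`, the image `η(A⁺)` of the nonempty words is a
group (a subsemigroup of `N` which is a group, with identity `e`), and the map `β`
sending `ε` to `e` and any nonempty word `w` to `η w` is a monoid morphism onto this
group which is a `G`-morphism. -/
theorem wellSuited_morphism_image_group {A : Type} [Fintype A] [Nonempty A]
    (G : LangClass A) (hG : IsGroupPrevariety G) {N : Type} [Monoid N] [Finite N]
    (η : FreeMonoid A →* N) (hη : IsCMorphism (wellSuited G) η) :
    ∃ e ∈ η '' {w : FreeMonoid A | w ≠ 1},
      (∀ x ∈ η '' {w : FreeMonoid A | w ≠ 1}, ∀ y ∈ η '' {w : FreeMonoid A | w ≠ 1},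
        x * y ∈ η '' {w : FreeMonoid A | w ≠ 1}) ∧
      (∀ x ∈ η '' {w : FreeMonoid A | w ≠ 1}, e * x = x ∧ x * e = x) ∧
      (∀ x ∈ η '' {w : FreeMonoid A | w ≠ 1},
        ∃ y ∈ η '' {w : FreeMonoid A | w ≠ 1}, x * y = e ∧ y * x = e) ∧
      ∃ β : FreeMonoid A → N,
        β 1 = e ∧ (∀ w : FreeMonoid A, w ≠ 1 → β w = η w) ∧
        (∀ u v : FreeMonoid A, β (u * v) = β u * β v) ∧
        Set.range β = η '' {w : FreeMonoid A | w ≠ 1} ∧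
        ∀ F : Set N, β ⁻¹' F ∈ G := by
  obtain ⟨n, hn, hins⟩ := exists_pow_insertion hG.2 η hη.2
  obtain ⟨a⟩ := ‹Nonempty A›
  have ha : FreeMonoid.of a ^ n ≠ 1 := pow_ne_one_of_ne_one (FreeMonoid.of_ne_one a) hn
  set z : FreeMonoid A := FreeMonoid.of a ^ n
  have hleft (w : FreeMonoid A) (hw : w ≠ 1) : η (z * w) = η w := by
    simpa [z] using hins 1 (FreeMonoid.of a) w (by simpa using hw)
  have hright (w : FreeMonoid A) (hw : w ≠ 1) : η (w * z) = η w := by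
    simpa [z] using hins w (FreeMonoid.of a) 1 (by simpa using hw)
  have hpow (w : FreeMonoid A) (hw : w ≠ 1) : η (w ^ n) = η z := by
    rw [← hright _ (pow_ne_one_of_ne_one hw hn)]
    simpa using hins 1 w z (by simpa using ha)
  refine ⟨η z, ⟨z, ha, rfl⟩, ?_, ?_, ?_, fun w => η (z * w), by simp, hleft, ?_, ?_, ?_⟩
  · rintro _ ⟨u, hu, rfl⟩ _ ⟨v, -, rfl⟩
    exact ⟨u * v, mul_ne_one_of_left hu v, map_mul η u v⟩
  · rintro _ ⟨w, hw, rfl⟩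
    simp only [← map_mul]
    exact ⟨hleft w hw, hright w hw⟩
  · rintro _ ⟨w, hw, rfl⟩
    have hsq : η (w ^ n * w ^ n) = η z := by
      rw [map_mul, hpow w hw, ← map_mul, hleft z ha]
    refine ⟨η (w ^ (n - 1) * w ^ n),
      ⟨_, mul_ne_one_of_right _ (pow_ne_one_of_ne_one hw hn), rfl⟩, ?_, ?_⟩
    · rw [← map_mul, ← mul_assoc, mul_pow_sub_one hn.ne', hsq]
    · rw [← map_mul, ← pow_add, ← pow_succ, ← hsq, ← pow_add]
      congr 2
      omega
  · intro u v
    beta_reduce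
    rw [← map_mul, ← mul_assoc, ← mul_assoc]
    exact (hins (z * u) (FreeMonoid.of a) v
      (mul_ne_one_of_left (mul_ne_one_of_left ha u) v)).symm
  · apply Set.Subset.antisymm
    · rintro _ ⟨w, rfl⟩
      exact ⟨z * w, mul_ne_one_of_left ha w, rfl⟩
    · rintro _ ⟨w, hw, rfl⟩
      exact ⟨w, hleft w hw⟩
  · intro F
    obtain ⟨K, hK, hKη⟩ := exists_mem_iff_of_mem_wellSuited (hη.2 F)
    convert (hG.1.2.1 K hK z).1 using 1
    ext w
    exact hKη (z * w) (mul_ne_one_of_left ha w)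

end RegLang
end

section
/- Let G be a prevariety of languages over a finite alphabet A, let α : A* → M be a monoid morphism into a finite monoid, and let N be the G-kernel of α. Then: (i) for every G-morphism η : A* → H and every s ∈ N, there exists a word w with α(w) = s and η(w) = 1_H; (ii) there exists a G-morphism η : A* → H such that for every word w, η(w) = 1_H implies α(w) ∈ N. -/
/- Common definitions: languages over a finite alphabet, classes of languages,
prevarieties, polynomial closure and its variants, separation, C-pairs, etc. -/

namespace RegLang

variable {A : Type}

theorem IsLatticeClass.sInter_mem {C : LangClass A} (hC : IsLatticeClass C) {S : Set (Lang A)}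
    (hS : S.Finite) (h : S ⊆ C) : ⋂₀ S ∈ C := by
  induction S, hS using Set.Finite.induction_on with
  | empty => simpa using hC.2.1
  | insert _ _ ih =>
    rw [Set.sInter_insert]
    exact hC.2.2.2 _ _ (h (Set.mem_insert _ _)) (ih ((Set.subset_insert _ _).trans h))

theorem IsLatticeClass.sUnion_mem {C : LangClass A} (hC : IsLatticeClass C) {S : Set (Lang A)}
    (hS : S.Finite) (h : S ⊆ C) : ⋃₀ S ∈ C := by
  induction S, hS using Set.Finite.induction_on with
  | empty => simpa using hC.1
  | insert _ _ ih =>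
    rw [Set.sUnion_insert]
    exact hC.2.2.1 _ _ (h (Set.mem_insert _ _)) (ih ((Set.subset_insert _ _).trans h))

/-- The syntactic congruence of a language. -/
def synCon (L : Lang A) : Con (FreeMonoid A) where
  r u v := ∀ x y : FreeMonoid A, x * u * y ∈ L ↔ x * v * y ∈ L
  iseqv :=
    ⟨fun _ _ _ => Iff.rfl, fun h x y => (h x y).symm, fun h h' x y => (h x y).trans (h' x y)⟩
  mul' {u u' v v'} h h' x y := by
    have h₁ := h x (v * y)
    have h₂ := h' (x * u') y
    simp only [mul_assoc] at h₁ h₂ ⊢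
    exact h₁.trans h₂

theorem synCon_iff {L : Lang A} {u v : FreeMonoid A} :
    synCon L u v ↔ ∀ x y : FreeMonoid A, x * u * y ∈ L ↔ x * v * y ∈ L :=
  Iff.rfl

theorem mem_iff_of_synCon {L : Lang A} {u v : FreeMonoid A} (h : synCon L u v) :
    u ∈ L ↔ v ∈ L := by
  simpa using h 1 1

theorem IsRegularLang.finite_synCon_quotient {L : Lang A} (hL : IsRegularLang L) :
    Finite (synCon L).Quotient := by
  obtain ⟨M, _, _, φ, F, rfl⟩ := hL
  refine Finite.of_injective (fun c : (synCon (φ ⁻¹' F)).Quotient => φ (Quotient.out c)) ?_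
  intro c d h
  rw [← Quotient.out_eq c, ← Quotient.out_eq d]
  refine Quotient.sound fun x y => ?_
  simp only at h
  simp [h]

/-- Every class of the syntactic congruence of a member of a prevariety is a member. -/
theorem IsPrevariety.synCon_class_mem {C : LangClass A} (hC : IsPrevariety C) {L : Lang A}
    (hL : L ∈ C) (v : FreeMonoid A) : {w | synCon L w v} ∈ C := by
  let T : FreeMonoid A × FreeMonoid A → Lang A :=
    fun p => {w | p.1 * w * p.2 ∈ L ↔ p.1 * v * p.2 ∈ L}
  have hT : {w | synCon L w v} = ⋂₀ Set.range T := by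
    ext w
    simp [T, synCon_iff]
  rw [hT]
  refine hC.1.1.sInter_mem ?_ ?_
  · obtain ⟨M, _, _, φ, F, rfl⟩ := hC.2.2 L hL
    refine (Set.finite_range fun q : M × M =>
      ({w | q.1 * φ w * q.2 ∈ F ↔ q.1 * φ v * q.2 ∈ F} : Lang A)).subset ?_
    rintro _ ⟨p, rfl⟩
    exact ⟨(φ p.1, φ p.2), by simp [T]⟩
  · rintro _ ⟨⟨x, y⟩, rfl⟩
    have hQ : {w | x * w * y ∈ L} ∈ C :=
      (hC.2.1 _ (hC.2.1 L hL y).2 x).1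
    by_cases hv : x * v * y ∈ L
    · simpa [T, hv] using hQ
    · simpa [T, hv, Set.compl_ofPred] using hC.1.2 _ hQ

theorem IsPrevariety.isCMorphism_synCon_mk' {C : LangClass A} (hC : IsPrevariety C) {L : Lang A}
    (hL : L ∈ C) : IsCMorphism C (synCon L).mk' := by
  refine ⟨Con.mk'_surjective, fun F => ?_⟩
  have := (hC.2.2 L hL).finite_synCon_quotient
  have hF : (synCon L).mk' ⁻¹' F = ⋃₀ ((fun c => (synCon L).mk' ⁻¹' {c}) '' F) := by
    ext w
    simp
  rw [hF]
  refine hC.1.1.sUnion_mem (F.toFinite.image _) ?_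
  rintro _ ⟨c, -, rfl⟩
  obtain ⟨v, rfl⟩ := Con.mk'_surjective c
  convert hC.synCon_class_mem hL v using 1
  ext w
  exact (synCon L).eq

/-- A single member of the class containing `ε` avoids every preimage of an element outside
the kernel. -/
theorem IsLatticeClass.exists_one_mem_subset_gKernel {C : LangClass A} (hC : IsLatticeClass C)
    {M : Type} [Monoid M] [Finite M] (α : FreeMonoid A →* M) :
    ∃ K ∈ C, (1 : FreeMonoid A) ∈ K ∧ ∀ w ∈ K, α w ∈ gKernel C α := by
  have h : ∀ s : ((gKernel C α)ᶜ : Set M), Separable C ({1} : Lang A) (α ⁻¹' {s.1}) :=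
    fun s => not_not.mp s.2
  choose K hK hsep using h
  refine ⟨⋂₀ Set.range K, hC.sInter_mem (Set.finite_range K) ?_, ?_, fun w hw => ?_⟩
  · rintro _ ⟨s, rfl⟩
    exact hK s
  · rintro _ ⟨s, rfl⟩
    exact (hsep s).1 rfl
  · by_contra hN
    have hmem : w ∈ K ⟨α w, hN⟩ ∩ α ⁻¹' {α w} := ⟨hw _ ⟨_, rfl⟩, rfl⟩
    rw [(hsep ⟨α w, hN⟩).2] at hmem
    exact hmem

/-- characterization of the `G`-kernel via `G`-morphisms. -/
theorem gKernel_cmorphism_characterization {A : Type} [Fintype A] (G : LangClass A)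
    (hG : IsPrevariety G) {M : Type} [Monoid M] [Finite M] (α : FreeMonoid A →* M) :
    (∀ (H : Type) (_ : Monoid H) (_ : Finite H) (η : FreeMonoid A →* H),
        IsCMorphism G η → ∀ s ∈ gKernel G α, ∃ w : FreeMonoid A, α w = s ∧ η w = 1) ∧
      (∃ (H : Type) (_ : Monoid H) (_ : Finite H) (η : FreeMonoid A →* H),
        IsCMorphism G η ∧ ∀ w : FreeMonoid A, η w = 1 → α w ∈ gKernel G α) := by
  refine ⟨fun H _ _ η hη s hs => ?_, ?_⟩
  · by_contra! h
    refine hs ⟨η ⁻¹' {1}, hη.2 {1}, by simp, ?_⟩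
    ext w
    simpa [and_comm] using h w
  · obtain ⟨K, hK, h_one, hsub⟩ := hG.1.1.exists_one_mem_subset_gKernel α
    refine ⟨(synCon K).Quotient, inferInstance, (hG.2.2 K hK).finite_synCon_quotient,
      (synCon K).mk', hG.isCMorphism_synCon_mk' hK, fun w hw => hsub w ?_⟩
    have hcon : synCon K w 1 := (synCon K).eq.mp hw
    exact (mem_iff_of_synCon hcon).mpr h_one

end RegLang
end

section
/- Let G be a prevariety of languages over a finite alphabet A and let α : A* → M be a monoid morphism into a finite monoid. Then the G-kernel of α is a submonoid of M (it contains 1_M and is closed under multiplication), and the strict G-kernel of α is a subsemigroup of M. -/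
/- Common definitions: languages over a finite alphabet, classes of languages,
prevarieties, polynomial closure and its variants, separation, C-pairs, etc. -/

namespace RegLang

variable {A : Type}

theorem one_mem_gKernel (G : LangClass A) {M : Type} [Monoid M] (α : FreeMonoid A →* M) :
    (1 : M) ∈ gKernel G α := by
  rintro ⟨K, -, h1, h2⟩
  have h : (1 : FreeMonoid A) ∈ K ∩ α ⁻¹' {1} := ⟨h1 rfl, map_one α⟩
  rw [h2] at h
  exact h

/-- Quotients on the right suffice for the kernel to be closed under multiplication: if `K`
separates `{ε}` from `α⁻¹(st)`, then `Kv⁻¹` is disjoint from `α⁻¹(s)` for all `v ∈ α⁻¹(t)`. -/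
theorem mul_mem_gKernel {G : LangClass A} (hG : QuotientClosed G) {M : Type} [Monoid M]
    {α : FreeMonoid A →* M} {s t : M} (hs : s ∈ gKernel G α) (ht : t ∈ gKernel G α) :
    s * t ∈ gKernel G α := by
  rintro ⟨K, hK, h1, h2⟩
  refine ht ⟨K, hK, h1, Set.eq_empty_of_forall_notMem ?_⟩
  rintro v ⟨hvK, hvt⟩
  refine hs ⟨_, (hG K hK v).2, ?_, Set.eq_empty_of_forall_notMem ?_⟩
  · rintro _ rfl
    simpa using hvK
  · rintro u ⟨huK, hus⟩
    have h : u * v ∈ K ∩ α ⁻¹' {s * t} := by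
      refine ⟨huK, ?_⟩
      rw [Set.mem_preimage, Set.mem_singleton_iff] at hus hvt ⊢
      rw [map_mul, hus, hvt]
    rw [h2] at h
    exact h

/-- the `G`-kernel is a submonoid and the strict `G`-kernel is a
subsemigroup. -/
theorem gKernel_submonoid {A : Type} [Fintype A] (G : LangClass A)
    (hG : IsPrevariety G) {M : Type} [Monoid M] [Finite M] (α : FreeMonoid A →* M) :
    ((1 : M) ∈ gKernel G α ∧
        ∀ s ∈ gKernel G α, ∀ t ∈ gKernel G α, s * t ∈ gKernel G α) ∧
      (∀ s ∈ strictGKernel G α, ∀ t ∈ strictGKernel G α,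
        s * t ∈ strictGKernel G α) := by
  refine ⟨⟨one_mem_gKernel G α, fun s hs t ht => mul_mem_gKernel hG.2.1 hs ht⟩, ?_⟩
  rintro _ ⟨hs, u, hu, rfl⟩ _ ⟨ht, v, hv, rfl⟩
  refine ⟨mul_mem_gKernel hG.2.1 hs ht, u * v, fun h => hu ?_, map_mul α u v⟩
  exact (List.append_eq_nil_iff.mp h).1

end RegLang
end

section
/- Let C be a lattice of languages over a finite alphabet A and let α : A* → M be a monoid morphism into a finite monoid. Then the canonical C-preorder ≼_C on M is exactly the reflexive transitive closure of the C-pair relation for α: for all s, t ∈ M, s ≼_C t if and only if there is a finite sequence s = r₀, r₁, …, r_k = t in M such that (r_i, r_{i+1}) is a C-pair for α for every i < k. -/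
/- Common definitions: languages over a finite alphabet, classes of languages,
prevarieties, polynomial closure and its variants, separation, C-pairs, etc. -/

namespace RegLang

variable {A : Type}

namespace IsLatticeClass

variable {C : LangClass A} {ι : Type*} [Finite ι] {f : ι → Lang A}

lemma iUnion_mem (hC : IsLatticeClass C) (hf : ∀ i, f i ∈ C) : ⋃ i, f i ∈ C :=
  SupClosed.iSup_mem (fun K hK L hL ↦ hC.2.2.1 K L hK hL) hC.1 hf

lemma iInter_mem (hC : IsLatticeClass C) (hf : ∀ i, f i ∈ C) : ⋂ i, f i ∈ C :=
  InfClosed.iInf_mem (fun K hK L hL ↦ hC.2.2.2 K L hK hL) hC.2.1 hf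

end IsLatticeClass

/-- A language recognized by `φ` belongs to a lattice `C` if and only if its accepting set is
closed under `C`-pairs. -/
lemma preimage_mem_iff_forall_cpair {C : LangClass A} (hC : IsLatticeClass C) {M : Type}
    [Monoid M] [Finite M] (φ : FreeMonoid A →* M) (F : Set M) :
    φ ⁻¹' F ∈ C ↔ ∀ s t, CPair C φ s t → s ∈ F → t ∈ F := by
  constructor
  · intro hF s t hst hs
    by_contra ht
    refine hst ⟨φ ⁻¹' F, hF, fun w hw ↦ ?_, Set.eq_empty_iff_forall_notMem.2 fun w hw ↦ ?_⟩
    · rwa [Set.mem_preimage, show φ w = s from hw]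
    · exact ht ((show φ w = t from hw.2) ▸ hw.1)
  · intro hF
    have hsep (s : F) (t : (Fᶜ : Set M)) : Separable C (φ ⁻¹' {s.1}) (φ ⁻¹' {t.1}) := by
      by_contra h
      exact t.2 (hF s t h s.2)
    choose K hK hsub hdisj using hsep
    suffices φ ⁻¹' F = ⋃ s, ⋂ t, K s t by
      rw [this]
      exact hC.iUnion_mem fun s ↦ hC.iInter_mem (hK s)
    ext w
    simp only [Set.mem_preimage, Set.mem_iUnion, Set.mem_iInter]
    refine ⟨fun hw ↦ ⟨⟨φ w, hw⟩, fun t ↦ hsub _ t rfl⟩, fun ⟨s, hs⟩ ↦ ?_⟩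
    by_contra hw
    exact Set.eq_empty_iff_forall_notMem.1 (hdisj s ⟨φ w, hw⟩) w ⟨hs _, rfl⟩

/-- for a lattice `C`, the canonical `C`-preorder is the reflexive
transitive closure of the `C`-pair relation. -/
theorem cpreorder_eq_reflTrans_cpair {A : Type} [Fintype A] (C : LangClass A)
    (hC : IsLatticeClass C) {M : Type} [Monoid M] [Finite M] (α : FreeMonoid A →* M) :
    ∀ s t : M, CPreorder C α s t ↔
      ∃ (k : ℕ) (r : ℕ → M), r 0 = s ∧ r k = t ∧
        ∀ i < k, CPair C α (r i) (r (i + 1)) := by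
  intro s t
  constructor
  · intro h
    refine h {t | ∃ (k : ℕ) (r : ℕ → M), r 0 = s ∧ r k = t ∧
      ∀ i < k, CPair C α (r i) (r (i + 1))} ?_ ⟨0, fun _ ↦ s, rfl, rfl, by simp⟩
    rw [preimage_mem_iff_forall_cpair hC]
    rintro _ v huv ⟨k, r, h0, rfl, hr⟩
    refine ⟨k + 1, Function.update r (k + 1) v, by simpa using h0, by simp, fun i hi ↦ ?_⟩
    rw [Function.update_of_ne hi.ne]
    obtain rfl | hik := eq_or_lt_of_le (Nat.le_of_lt_succ hi)
    · simpa using huv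
    · rw [Function.update_of_ne (by lia)]
      exact hr i hik
  · rintro ⟨k, r, rfl, rfl, hr⟩ F hF h0
    have hmem : ∀ i ≤ k, r i ∈ F := by
      intro i
      induction i with
      | zero => exact fun _ ↦ h0
      | succ i ih =>
        exact fun hi ↦ (preimage_mem_iff_forall_cpair hC α F).1 hF _ _ (hr i hi) (ih (by lia))
    exact hmem k le_rfl

end RegLang
end

section
/- Let C be a prevariety of languages over a finite alphabet A. Then Pol(BPol(C)) = Pol(coPol(C)). -/
/- Common definitions: languages over a finite alphabet, classes of languages,
prevarieties, polynomial closure and its variants, separation, C-pairs, etc. -/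

namespace RegLang

variable {A : Type}

/-- `L` splits over `D`: the relation `u * v ∈ L` is a finite union of products of
languages in `D`. -/
def Splits (D : LangClass A) (L : Lang A) : Prop :=
  ∃ S : Set (Lang A × Lang A), S.Finite ∧ (∀ p ∈ S, p.1 ∈ D ∧ p.2 ∈ D) ∧
    ∀ u v : FreeMonoid A, u * v ∈ L ↔ ∃ p ∈ S, u ∈ p.1 ∧ v ∈ p.2

/-- A lattice of languages each of whose members splits over the lattice. -/
def IsSplitLattice (D : LangClass A) : Prop :=
  IsLatticeClass D ∧ ∀ L ∈ D, Splits D L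

theorem biUnion_mem_of_closed {D : LangClass A} (h0 : ∅ ∈ D)
    (hU : ∀ K L : Lang A, K ∈ D → L ∈ D → K ∪ L ∈ D) {ι : Type*} {S : Set ι}
    (hS : S.Finite) {f : ι → Lang A} : (∀ i ∈ S, f i ∈ D) → (⋃ i ∈ S, f i) ∈ D := by
  induction S, hS using Set.Finite.induction_on with
  | empty => intro _; simpa using h0
  | insert _ _ ih =>
    intro h
    rw [Set.biUnion_insert]
    exact hU _ _ (h _ (Set.mem_insert _ _)) (ih fun i hi => h i (Set.mem_insert_of_mem _ hi))

theorem IsLatticeClass.biUnion_mem {D : LangClass A} (hD : IsLatticeClass D) {ι : Type*}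
    {S : Set ι} (hS : S.Finite) {f : ι → Lang A} (h : ∀ i ∈ S, f i ∈ D) :
    (⋃ i ∈ S, f i) ∈ D :=
  biUnion_mem_of_closed hD.1 hD.2.2.1 hS h

theorem IsLatticeClass.biInter_mem {D : LangClass A} (hD : IsLatticeClass D) {ι : Type*}
    {S : Set ι} (hS : S.Finite) {f : ι → Lang A} :
    (∀ i ∈ S, f i ∈ D) → (⋂ i ∈ S, f i) ∈ D := by
  induction S, hS using Set.Finite.induction_on with
  | empty => intro _; simpa using hD.2.1
  | insert _ _ ih =>
    intro h
    rw [Set.biInter_insert]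
    exact hD.2.2.2 _ _ (h _ (Set.mem_insert _ _))
      (ih fun i hi => h i (Set.mem_insert_of_mem _ hi))

theorem IsPositivePrevariety.isSplitLattice {D : LangClass A} (hD : IsPositivePrevariety D) :
    IsSplitLattice D := by
  obtain ⟨hlat, hquot, hreg⟩ := hD
  refine ⟨hlat, fun L hL => ?_⟩
  obtain ⟨M, _, _, φ, F, rfl⟩ := hreg L hL
  let U : M → Lang A := fun m => ⋂ n ∈ {n ∈ Set.range φ | m * n ∈ F}, {u | φ u * n ∈ F}
  let V : M → Lang A := fun m => {v | m * φ v ∈ F}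
  refine ⟨(fun m => (U m, V m)) '' Set.range φ, Set.toFinite _, ?_, fun u v => ?_⟩
  · rintro _ ⟨_, ⟨w, rfl⟩, rfl⟩
    refine ⟨hlat.biInter_mem (Set.toFinite _) ?_, ?_⟩
    · rintro _ ⟨⟨x, rfl⟩, -⟩
      simpa using (hquot _ hL x).2
    · simpa using (hquot _ hL w).1
  · constructor
    · intro h
      refine ⟨_, ⟨φ u, ⟨u, rfl⟩, rfl⟩, ?_, ?_⟩
      · simp only [U, Set.mem_iInter]
        exact fun n hn => hn.2
      · simpa [V] using h
    · rintro ⟨_, ⟨m, -, rfl⟩, hu, hv⟩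
      simp only [U, Set.mem_iInter] at hu
      simpa using hu (φ v) ⟨⟨v, rfl⟩, hv⟩

theorem IsPrevariety.isSplitLattice {C : LangClass A} (hC : IsPrevariety C) :
    IsSplitLattice C :=
  IsPositivePrevariety.isSplitLattice ⟨hC.1.1, hC.2.1, hC.2.2⟩

theorem mul_eq_mul_of_mul_iff {u v x y : FreeMonoid A} {a : A} :
    u * v = x * FreeMonoid.of a * y ↔
      (∃ t, u = x * FreeMonoid.of a * t ∧ y = t * v) ∨
        ∃ t, x = u * t ∧ v = t * FreeMonoid.of a * y := by
  constructor
  · intro h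
    rw [mul_assoc] at h
    rcases List.append_eq_append_iff.1 (show u.toList ++ v.toList = x.toList ++ a :: y.toList from h)
      with ⟨t, hx, hv⟩ | ⟨t, hu, hv⟩
    · exact Or.inr ⟨FreeMonoid.ofList t, hx, by rw [mul_assoc]; exact hv⟩
    · cases t with
      | nil =>
        refine Or.inr ⟨1, ?_, ?_⟩
        · simpa using hu.symm
        · rw [one_mul]; exact hv.symm
      | cons b t =>
        obtain ⟨rfl, hy⟩ := List.cons.inj hv
        exact Or.inl ⟨FreeMonoid.ofList t, by rw [mul_assoc]; exact hu, hy⟩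
  · rintro (⟨t, rfl, rfl⟩ | ⟨t, rfl, rfl⟩) <;> simp only [mul_assoc]

theorem Splits.mono {D E : LangClass A} (h : D ⊆ E) {L : Lang A} (hL : Splits D L) :
    Splits E L := by
  obtain ⟨S, hS, hmem, hiff⟩ := hL
  exact ⟨S, hS, fun p hp => ⟨h (hmem p hp).1, h (hmem p hp).2⟩, hiff⟩

theorem Splits.union {D : LangClass A} {K L : Lang A} (hK : Splits D K) (hL : Splits D L) :
    Splits D (K ∪ L) := by
  obtain ⟨S, hS, hSm, hSi⟩ := hK
  obtain ⟨T, hT, hTm, hTi⟩ := hL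
  refine ⟨S ∪ T, hS.union hT, fun p hp => hp.elim (hSm p) (hTm p), fun u v => ?_⟩
  rw [Set.mem_union, hSi, hTi]
  simp only [Set.mem_union, or_and_right, exists_or]

theorem Splits.markedCat {D : LangClass A} (a : A)
    (hD : ∀ K L : Lang A, K ∈ D → L ∈ D → MarkedCat K a L ∈ D) {K L : Lang A}
    (hKD : K ∈ D) (hLD : L ∈ D) (hK : Splits D K) (hL : Splits D L) :
    Splits D (MarkedCat K a L) := by
  obtain ⟨S, hS, hSm, hSi⟩ := hK
  obtain ⟨T, hT, hTm, hTi⟩ := hL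
  refine ⟨(fun p => (MarkedCat K a p.1, p.2)) '' T ∪ (fun p => (p.1, MarkedCat p.2 a L)) '' S,
    (hT.image _).union (hS.image _), ?_, fun u v => ?_⟩
  · rintro _ (⟨p, hp, rfl⟩ | ⟨p, hp, rfl⟩)
    · exact ⟨hD _ _ hKD (hTm p hp).1, (hTm p hp).2⟩
    · exact ⟨(hSm p hp).1, hD _ _ (hSm p hp).2 hLD⟩
  · constructor
    · rintro ⟨x, hx, y, hy, h⟩
      rcases mul_eq_mul_of_mul_iff.1 h with ⟨t, rfl, rfl⟩ | ⟨t, rfl, rfl⟩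
      · obtain ⟨p, hp, h1, h2⟩ := (hTi _ _).1 hy
        exact ⟨_, Or.inl ⟨p, hp, rfl⟩, ⟨x, hx, t, h1, rfl⟩, h2⟩
      · obtain ⟨p, hp, h1, h2⟩ := (hSi _ _).1 hx
        exact ⟨_, Or.inr ⟨p, hp, rfl⟩, h1, ⟨t, h2, y, hy, rfl⟩⟩
    · rintro ⟨_, ⟨p, hp, rfl⟩ | ⟨p, hp, rfl⟩, h1, h2⟩
      · obtain ⟨x, hx, t, ht, rfl⟩ := h1
        exact ⟨x, hx, t * v, (hTi _ _).2 ⟨p, hp, ht, h2⟩, by simp only [mul_assoc]⟩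
      · obtain ⟨t, ht, y, hy, rfl⟩ := h2
        exact ⟨u * t, (hSi _ _).2 ⟨p, hp, h1, ht⟩, y, hy, by simp only [mul_assoc]⟩

theorem Splits.leftQuotient_mem {D : LangClass A} (h0 : ∅ ∈ D)
    (hU : ∀ K L : Lang A, K ∈ D → L ∈ D → K ∪ L ∈ D) {L : Lang A} (hL : Splits D L)
    (u : FreeMonoid A) : {w : FreeMonoid A | u * w ∈ L} ∈ D := by
  obtain ⟨S, hS, hSm, hSi⟩ := hL
  have : {w : FreeMonoid A | u * w ∈ L} = ⋃ p ∈ {p ∈ S | u ∈ p.1}, p.2 := by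
    ext w
    simp only [Set.mem_ofPred_eq, hSi, Set.mem_iUnion, exists_prop, and_assoc]
  rw [this]
  exact biUnion_mem_of_closed h0 hU (hS.subset (Set.sep_subset _ _)) fun p hp => (hSm p hp.1).2

/-- In a class closed under finite unions all of whose members split, the intersection of a
member with a marked concatenation decomposes through finitely many intersections. -/
theorem markedCat_inter_eq {D : LangClass A} (h0 : ∅ ∈ D)
    (hU : ∀ K L : Lang A, K ∈ D → L ∈ D → K ∪ L ∈ D) (hs : ∀ L ∈ D, Splits D L)
    (K K' : Lang A) (a : A) {L : Lang A} (hL : L ∈ D) :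
    ∃ S : Set (Lang A × Lang A), S.Finite ∧ (∀ p ∈ S, p.1 ∈ D ∧ p.2 ∈ D) ∧
      MarkedCat K a K' ∩ L = ⋃ p ∈ S, MarkedCat (K ∩ p.1) a (K' ∩ p.2) := by
  obtain ⟨S, hS, hSm, hSi⟩ := hs L hL
  refine ⟨(fun p => (p.1, {w | FreeMonoid.of a * w ∈ p.2})) '' S, hS.image _, ?_, ?_⟩
  · rintro _ ⟨p, hp, rfl⟩
    exact ⟨(hSm p hp).1, (hs _ (hSm p hp).2).leftQuotient_mem h0 hU _⟩
  · ext w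
    simp only [Set.mem_iUnion, exists_prop]
    constructor
    · rintro ⟨⟨u, hu, v, hv, rfl⟩, h⟩
      rw [mul_assoc] at h
      obtain ⟨p, hp, h1, h2⟩ := (hSi _ _).1 h
      exact ⟨_, ⟨p, hp, rfl⟩, u, ⟨hu, h1⟩, v, ⟨hv, h2⟩, rfl⟩
    · rintro ⟨_, ⟨p, hp, rfl⟩, u, ⟨hu, h1⟩, v, ⟨hv, h2⟩, rfl⟩
      refine ⟨⟨u, hu, v, hv, rfl⟩, ?_⟩
      rw [mul_assoc]
      exact (hSi _ _).2 ⟨p, hp, h1, h2⟩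

theorem Pol.mono {D E : LangClass A} (h : ∀ L ∈ D, Pol E L) {L : Lang A} (hL : Pol D L) :
    Pol E L := by
  induction hL with
  | base hL => exact h _ hL
  | union _ _ ihK ihL => exact ihK.union ihL
  | mcat a _ _ ihK ihL => exact ihK.mcat a ihL

theorem Pol.biUnion {D : LangClass A} (h0 : ∅ ∈ D) {ι : Type*} {S : Set ι} (hS : S.Finite)
    {f : ι → Lang A} (h : ∀ i ∈ S, Pol D (f i)) : Pol D (⋃ i ∈ S, f i) :=
  biUnion_mem_of_closed (D := {L | Pol D L}) (Pol.base h0) (fun _ _ => Pol.union) hS h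

theorem IsSplitLattice.splits_of_pol {D : LangClass A} (hD : IsSplitLattice D) {L : Lang A}
    (hL : Pol D L) : Splits {L | Pol D L} L := by
  induction hL with
  | base hL => exact (hD.2 _ hL).mono fun _ => Pol.base
  | union _ _ ihK ihL => exact ihK.union ihL
  | mcat a hK hL ihK ihL => exact Splits.markedCat a (fun _ _ h h' => h.mcat a h') hK hL ihK ihL

theorem IsSplitLattice.pol_inter_of_mem {D : LangClass A} (hD : IsSplitLattice D) {L : Lang A}
    (hL : Pol D L) : ∀ K ∈ D, Pol D (L ∩ K) := by
  induction hL with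
  | base hL => exact fun K hK => Pol.base (hD.1.2.2.2 _ _ hL hK)
  | union _ _ ihK ihL =>
    intro K hK
    rw [Set.union_inter_distrib_right]
    exact (ihK K hK).union (ihL K hK)
  | mcat a _ _ ihK ihL =>
    intro K hK
    obtain ⟨S, hS, hSm, h⟩ := markedCat_inter_eq hD.1.1 hD.1.2.2.1 hD.2 _ _ a hK
    rw [h]
    exact Pol.biUnion hD.1.1 hS fun p hp => (ihK _ (hSm p hp).1).mcat a (ihL _ (hSm p hp).2)

theorem IsSplitLattice.pol_inter {D : LangClass A} (hD : IsSplitLattice D) {K : Lang A}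
    (hK : Pol D K) : ∀ L, Pol D L → Pol D (K ∩ L) := by
  induction hK with
  | base hK =>
    intro L hL
    rw [Set.inter_comm]
    exact hD.pol_inter_of_mem hL _ hK
  | union _ _ ihK ihL =>
    intro L hL
    rw [Set.union_inter_distrib_right]
    exact (ihK L hL).union (ihL L hL)
  | mcat a _ _ ihK ihL =>
    intro L hL
    obtain ⟨S, hS, hSm, h⟩ := markedCat_inter_eq (D := {L | Pol D L}) (Pol.base hD.1.1)
      (fun _ _ => Pol.union) (fun _ => hD.splits_of_pol) _ _ a hL
    rw [h]
    exact Pol.biUnion hD.1.1 hS fun p hp => (ihK _ (hSm p hp).1).mcat a (ihL _ (hSm p hp).2)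

theorem IsSplitLattice.pol {D : LangClass A} (hD : IsSplitLattice D) :
    IsSplitLattice {L | Pol D L} :=
  ⟨⟨Pol.base hD.1.1, Pol.base hD.1.2.1, fun _ _ => Pol.union,
    fun _ L hK hL => hD.pol_inter hK L hL⟩, fun _ => hD.splits_of_pol⟩

theorem IsSplitLattice.compl {D : LangClass A} (hD : IsSplitLattice D) :
    IsSplitLattice {L | Lᶜ ∈ D} := by
  obtain ⟨hlat, hs⟩ := hD
  have hlat' : IsLatticeClass {L : Lang A | Lᶜ ∈ D} := by
    refine ⟨?_, ?_, fun K L hK hL => ?_, fun K L hK hL => ?_⟩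
    · simpa using hlat.2.1
    · simpa using hlat.1
    · simpa [Set.compl_union] using hlat.2.2.2 _ _ hK hL
    · simpa [Set.compl_inter] using hlat.2.2.1 _ _ hK hL
  refine ⟨hlat', fun L hL => ?_⟩
  obtain ⟨S, hS, hSm, hSi⟩ := hs _ hL
  refine ⟨(fun T => (⋂ p ∈ T, p.1ᶜ, ⋂ p ∈ S \ T, p.2ᶜ)) '' 𝒫 S, hS.powerset.image _, ?_,
    fun u v => ?_⟩
  · rintro _ ⟨T, hT, rfl⟩
    refine ⟨hlat'.biInter_mem (hS.subset hT) fun p hp => ?_,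
      hlat'.biInter_mem (hS.subset Set.sdiff_subset) fun p hp => ?_⟩
    · simpa using (hSm p (hT hp)).1
    · simpa using (hSm p hp.1).2
  · rw [← not_iff_not, ← Set.mem_compl_iff, hSi]
    constructor
    · rintro ⟨p, hp, h1, h2⟩ ⟨_, ⟨T, hT, rfl⟩, hu, hv⟩
      simp only [Set.mem_iInter] at hu hv
      by_cases hpT : p ∈ T
      · exact hu p hpT h1
      · exact hv p ⟨hp, hpT⟩ h2
    · intro h
      by_contra! hn
      refine h ⟨_, ⟨{p ∈ S | u ∉ p.1}, Set.sep_subset _ _, rfl⟩, ?_, ?_⟩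
      · simp only [Set.mem_iInter]
        exact fun p hp => hp.2
      · simp only [Set.mem_iInter]
        rintro p ⟨hp, hpT⟩
        exact hn p hp (by_contra fun hu => hpT ⟨hp, hu⟩)

theorem coPol_eq (C : LangClass A) : coPol C = {L | Lᶜ ∈ {K | Pol C K}} := by
  ext L
  constructor
  · rintro ⟨K, hK, rfl⟩
    simpa using hK
  · exact fun h => ⟨Lᶜ, h, (compl_compl L).symm⟩

theorem BPol.pol_coPol {C : LangClass A} (hC : IsPrevariety C) {L : Lang A} (hL : BPol C L) :
    Pol (coPol C) L ∧ Pol (coPol C) Lᶜ := by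
  have hco : IsSplitLattice (coPol C) := by
    rw [coPol_eq]
    exact hC.isSplitLattice.pol.compl
  induction hL with
  | base hL =>
    refine ⟨hL.mono fun K hK => Pol.base ?_, Pol.base ⟨_, hL, rfl⟩⟩
    exact ⟨Kᶜ, Pol.base (hC.1.2 K hK), (compl_compl K).symm⟩
  | empty => exact ⟨Pol.base hco.1.1, by simpa using Pol.base hco.1.2.1⟩
  | univ => exact ⟨Pol.base hco.1.2.1, by simpa using Pol.base hco.1.1⟩
  | union _ _ ihK ihL =>
    refine ⟨ihK.1.union ihL.1, ?_⟩
    rw [Set.compl_union]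
    exact hco.pol_inter ihK.2 _ ihL.2
  | inter _ _ ihK ihL =>
    refine ⟨hco.pol_inter ihK.1 _ ihL.1, ?_⟩
    rw [Set.compl_inter]
    exact ihK.2.union ihL.2
  | compl _ ih => exact ⟨ih.2, by simpa using ih.1⟩

/-- for a prevariety `C`, `Pol (BPol C) = Pol (coPol C)`. -/
theorem pol_bpol_eq_pol_copol {A : Type} [Fintype A] (C : LangClass A)
    (hC : IsPrevariety C) :
    {L : Lang A | Pol {K : Lang A | BPol C K} L} =
      {L : Lang A | Pol (coPol C) L} := by
  ext L
  constructor
  · exact Pol.mono fun K hK => (BPol.pol_coPol hC hK).1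
  · refine Pol.mono ?_
    rintro _ ⟨K, hK, rfl⟩
    exact Pol.base (BPol.base hK).compl

end RegLang
end
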